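/- arXiv:2112.12746 — 2 statements merged into one kernel-verified Lean document; each statement's English description precedes it below -/
import Mathlib

section
/- Let P be a lazy row-stochastic matrix on a finite set V (i.e., P = (I + Q)/2 for some row-stochastic Q), reversible with respect to a probability distribution π, let M ⊆ V be a marked set with π(U) > 0, and let T be a positive integer. Then Σ_{t=1}^{T} Σ_{t'=1}^{T} π̃_U · P^{2t} · Π_M · P^{2t'} · 1_U ≥ (1/16) · Σ_{t=1}^{T} Σ_{t'=1}^{T} π̃_U · P^{t} · Π_M · P^{t'} · 1_U. (The left-hand side concerns the discrete-time chain with transition matrix P², the right-hand side the chain with transition matrix P.) -/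
open Matrix

/-- The `n`-th power of a matrix in detailed balance with `π` is in detailed balance with `π`. -/
theorem detailed_balance_pow {V R : Type*} [Fintype V] [DecidableEq V] [CommSemiring R]
    {P : Matrix V V R} {π : V → R} (hrev : ∀ x y, π x * P x y = π y * P y x) (n : ℕ) (x y : V) :
    π x * (P ^ n) x y = π y * (P ^ n) y x := by
  induction n generalizing x y with
  | zero => by_cases h : x = y <;> simp [h, eq_comm]
  | succ n ih =>
    rw [pow_succ, Matrix.mul_apply, ← pow_succ, pow_succ', Matrix.mul_apply, Finset.mul_sum,
      Finset.mul_sum]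
    refine Finset.sum_congr rfl fun z _ => ?_
    rw [← mul_assoc, ih x z, mul_right_comm, hrev z y]
    ring

/-- If `a` is nonnegative and at most halves in each step, the sum of its even-indexed terms
controls the sum of an initial segment. -/
theorem sum_Icc_le_three_mul_sum_Icc_even {a : ℕ → ℝ} (ha : ∀ t, 0 ≤ a t)
    (hstep : ∀ t, a t ≤ 2 * a (t + 1)) (T : ℕ) :
    ∑ t ∈ Finset.Icc 1 T, a t ≤ 3 * ∑ t ∈ Finset.Icc 1 T, a (2 * t) := by
  have double : ∀ n, ∑ t ∈ Finset.Icc 1 (2 * n), a t ≤ 3 * ∑ t ∈ Finset.Icc 1 n, a (2 * t) := by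
    intro n
    induction n with
    | zero => simp
    | succ n ih =>
      rw [show 2 * (n + 1) = 2 * n + 1 + 1 by ring, Finset.sum_Icc_succ_top (by omega),
        Finset.sum_Icc_succ_top (by omega), Finset.sum_Icc_succ_top (by omega),
        show 2 * (n + 1) = 2 * n + 1 + 1 by ring]
      linarith [hstep (2 * n + 1)]
  exact (Finset.sum_le_sum_of_subset_of_nonneg (Finset.Icc_subset_Icc_right (by omega))
    fun t _ _ => ha t).trans (double T)

/-- Let `P` be a lazy row-stochastic matrix on a finite set `V` (i.e.
`P = (I + Q)/2` for some row-stochastic `Q`), reversible with respect to a probability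
distribution `π`, let `M ⊆ V` be a marked set with `π(U) > 0` where `U = V \ M`, and let `T`
be a positive integer.  Then
`∑_{t,t'=1}^T π̃_U · P^{2t} · Π_M · P^{2t'} · 1_U ≥ (1/16) ∑_{t,t'=1}^T π̃_U · P^t · Π_M · P^{t'} · 1_U`. -/
theorem lazy_square_walk_lower_bound {V : Type*} [Fintype V] [DecidableEq V]
    (P Q : Matrix V V ℝ) (π : V → ℝ) (M : Finset V)
    (hQnonneg : ∀ x y, 0 ≤ Q x y) (hQrow : ∀ x, ∑ y, Q x y = 1)
    (hlazy : P = (2 : ℝ)⁻¹ • (1 + Q))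
    (hπnonneg : ∀ x, 0 ≤ π x) (hπsum : ∑ x, π x = 1)
    (hrev : ∀ x y, π x * P x y = π y * P y x)
    (hU : 0 < ∑ x ∈ Mᶜ, π x)
    (πU : V → ℝ) (hπU : ∀ x, πU x = if x ∈ M then 0 else π x / ∑ y ∈ Mᶜ, π y)
    (projM : Matrix V V ℝ)
    (hprojM : projM = Matrix.diagonal (fun x => if x ∈ M then (1 : ℝ) else 0))
    (oneU : V → ℝ) (honeU : ∀ x, oneU x = if x ∈ M then 0 else 1)
    (T : ℕ) (hT : 1 ≤ T) :
    (1 / 16 : ℝ) * ∑ t ∈ Finset.Icc 1 T, ∑ t' ∈ Finset.Icc 1 T,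
        πU ⬝ᵥ (P ^ t).mulVec (projM.mulVec ((P ^ t').mulVec oneU)) ≤
      ∑ t ∈ Finset.Icc 1 T, ∑ t' ∈ Finset.Icc 1 T,
        πU ⬝ᵥ (P ^ (2 * t)).mulVec (projM.mulVec ((P ^ (2 * t')).mulVec oneU)) := by
  set c := ∑ y ∈ Mᶜ, π y
  let a : V → ℕ → ℝ := fun m t => (P ^ t).mulVec oneU m
  let w : V → ℝ := fun m => if m ∈ M then π m / c else 0
  have hw : ∀ m, 0 ≤ w m := fun m => by
    dsimp only [w]
    split_ifs
    exacts [div_nonneg (hπnonneg m) hU.le, le_rfl]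
  have ha_succ : ∀ m t, a m (t + 1) = 2⁻¹ * (a m t + ∑ y, Q m y * a y t) := fun m t => by
    change (P ^ (t + 1)).mulVec oneU m = _
    rw [pow_succ', ← Matrix.mulVec_mulVec]
    nth_rw 1 [hlazy]
    rw [Matrix.smul_mulVec, Matrix.add_mulVec, Matrix.one_mulVec]
    rfl
  have ha : ∀ t m, 0 ≤ a m t := fun t => by
    induction t with
    | zero =>
      intro m
      simp only [a, pow_zero, Matrix.one_mulVec, honeU]
      split_ifs <;> simp
    | succ t ih =>
      intro m
      rw [ha_succ]
      have := Finset.sum_nonneg fun y (_ : y ∈ Finset.univ) => mul_nonneg (hQnonneg m y) (ih y)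
      linarith [ih m]
  have hstep : ∀ m t, a m t ≤ 2 * a m (t + 1) := fun m t => by
    have := Finset.sum_nonneg fun y (_ : y ∈ Finset.univ) => mul_nonneg (hQnonneg m y) (ha t y)
    rw [ha_succ]
    linarith
  have hvec : ∀ s m, (πU ᵥ* (P ^ s)) m = π m / c * a m s := fun s m => by
    simp only [a, Matrix.vecMul, Matrix.mulVec, dotProduct, Finset.mul_sum]
    refine Finset.sum_congr rfl fun x _ => ?_
    have h := detailed_balance_pow hrev s x m
    rw [hπU, honeU]
    split_ifs
    · simp
    · rw [div_mul_eq_mul_div, h]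
      ring
  have hterm : ∀ s s', πU ⬝ᵥ (P ^ s).mulVec (projM.mulVec ((P ^ s').mulVec oneU)) =
      ∑ m, w m * (a m s * a m s') := fun s s' => by
    rw [Matrix.dotProduct_mulVec, dotProduct]
    refine Finset.sum_congr rfl fun m _ => ?_
    rw [hvec, hprojM, Matrix.mulVec_diagonal]
    change _ * (_ * a m s') = _
    dsimp only [w]
    split_ifs <;> ring
  have hsum : ∀ f : ℕ → ℕ, ∑ t ∈ Finset.Icc 1 T, ∑ t' ∈ Finset.Icc 1 T,
      πU ⬝ᵥ (P ^ f t).mulVec (projM.mulVec ((P ^ f t').mulVec oneU)) =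
      ∑ m, w m * (∑ t ∈ Finset.Icc 1 T, a m (f t)) ^ 2 := fun f => by
    simp_rw [hterm, sq, Finset.sum_mul_sum, Finset.mul_sum]
    rw [Finset.sum_comm (s := Finset.univ)]
    exact Finset.sum_congr rfl fun t _ => Finset.sum_comm
  rw [hsum fun t => t, hsum fun t => 2 * t, Finset.mul_sum]
  refine Finset.sum_le_sum fun m _ => ?_
  have h := sum_Icc_le_three_mul_sum_Icc_even (fun t => ha t m) (hstep m) T
  have h0 : 0 ≤ ∑ t ∈ Finset.Icc 1 T, a m t := Finset.sum_nonneg fun t _ => ha t m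
  have hsq : 1 / 16 * (∑ t ∈ Finset.Icc 1 T, a m t) ^ 2 ≤
      (∑ t ∈ Finset.Icc 1 T, a m (2 * t)) ^ 2 := by
    nlinarith
  calc _ = w m * (1 / 16 * (∑ t ∈ Finset.Icc 1 T, a m t) ^ 2) := by ring
    _ ≤ _ := mul_le_mul_of_nonneg_left hsq (hw m)
end

section
/- Let P be a row-stochastic matrix on a finite set V with stationary probability distribution π (πP = π), let M ⊆ V be a marked set with p_M = Σ_{x∈M} π(x) < 1, let P' be the absorbing chain obtained from P by replacing every row indexed by a marked node with the corresponding row of the identity, and for s ∈ [0,1) let P(s) = (1−s)P + sP'. Define the row vector π(s) by π(s)(x) = (1−s)·π(x)/(1 − s(1 − p_M)) for x ∉ M and π(s)(x) = π(x)/(1 − s(1 − p_M)) for x ∈ M. Then π(s) is a probability distribution on V and is stationary for P(s): π(s)·P(s) = π(s). -/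
/-- Let `P` be row-stochastic on a finite set `V` with stationary probability
distribution `π`, let `M` be a marked set with `p_M = π(M) < 1`, let `P'` be the absorbing chain
and `P(s) = (1-s)P + sP'` for `s ∈ [0,1)`.  Then the vector `π(s)` defined by
`π(s)(x) = (1-s)π(x)/(1 - s(1-p_M))` for `x ∉ M` and `π(x)/(1 - s(1-p_M))` for `x ∈ M`
is a probability distribution on `V` and is stationary for `P(s)`. -/
theorem interpolated_stationary_distribution {V : Type*} [Fintype V] [DecidableEq V]
    (P : Matrix V V ℝ) (π : V → ℝ) (M : Finset V)
    (hPnonneg : ∀ x y, 0 ≤ P x y) (hProw : ∀ x, ∑ y, P x y = 1)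
    (hπnonneg : ∀ x, 0 ≤ π x) (hπsum : ∑ x, π x = 1)
    (hstat : ∀ y, ∑ x, π x * P x y = π y)
    (pM : ℝ) (hpM : pM = ∑ x ∈ M, π x) (hpMlt : pM < 1)
    (P' : Matrix V V ℝ)
    (hP' : ∀ x y, P' x y = if x ∈ M then (if x = y then (1 : ℝ) else 0) else P x y)
    (s : ℝ) (hs : s ∈ Set.Ico (0 : ℝ) 1)
    (Ps : Matrix V V ℝ) (hPs : Ps = (1 - s) • P + s • P')
    (πs : V → ℝ)
    (hπs : ∀ x, πs x = if x ∈ M then π x / (1 - s * (1 - pM))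
      else (1 - s) * π x / (1 - s * (1 - pM))) :
    (∀ x, 0 ≤ πs x) ∧ (∑ x, πs x = 1) ∧ (∀ y, ∑ x, πs x * Ps x y = πs y) := by
  obtain ⟨hs0, hs1⟩ := hs
  have hpM0 : 0 ≤ pM := hpM ▸ Finset.sum_nonneg fun x _ => hπnonneg x
  have hD : 0 < 1 - s * (1 - pM) := by nlinarith
  have hπs_eq : ∀ x, πs x =
      ((1 - s) * π x + s * (if x ∈ M then π x else 0)) / (1 - s * (1 - pM)) := by
    intro x
    rw [hπs]
    split_ifs <;> ring
  refine ⟨fun x => ?_, ?_, fun y => ?_⟩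
  · have hx := hπnonneg x
    have hs' := sub_nonneg.2 hs1.le
    rw [hπs]
    split_ifs <;> positivity
  · simp_rw [hπs_eq]
    rw [← Finset.sum_div, Finset.sum_add_distrib, ← Finset.mul_sum, ← Finset.mul_sum,
      hπsum, Finset.sum_ite_mem, Finset.univ_inter, ← hpM, div_eq_one_iff_eq hD.ne']
    ring
  · have hterm : ∀ x, πs x * Ps x y =
        ((1 - s) * (π x * P x y) + s * (if x = y then (if x ∈ M then π x else 0) else 0)) /
          (1 - s * (1 - pM)) := by
      intro x
      simp only [hπs, hPs, hP', Matrix.add_apply, Matrix.smul_apply, smul_eq_mul]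
      split_ifs <;> ring
    simp_rw [hterm]
    rw [← Finset.sum_div, Finset.sum_add_distrib, ← Finset.mul_sum, ← Finset.mul_sum,
      hstat, Finset.sum_ite_eq' Finset.univ y, if_pos (Finset.mem_univ y), hπs_eq]
end
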